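/- arXiv:1108.3201 — 5 statements merged into one kernel-verified Lean document; each statement's English description precedes it below -/
import Mathlib

section
/- Let P be a transition matrix on a finite set D that is irreducible and reversible with respect to a (positive) probability measure π, with real eigenvalues 1 = β₀ > β₁ ≥ … ≥ β_{|D|−1} ≥ −1 and ⟨·,·⟩-orthonormal eigenbasis u₀ ≡ 1, u₁, …, u_{|D|−1}. If (X_n) is a Markov chain with transition matrix P and initial distribution π, then for every f : D → ℝ the mean square error of S_n(f) = (1/n)Σ_{j=1}^n f(X_j) satisfies e_π(S_n,f)² = (1/n²) Σ_{k=1}^{|D|−1} a_k² · W(n,β_k), where a_k = ⟨f,u_k⟩ and W(n,β) = (n(1−β²) − 2β(1−βⁿ))/(1−β)². -/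
open Finset

/-- Expectation, under the Markov chain with transition matrix `P` and initial
distribution `ν`, of a function `g` of the first `m+1` states `X₁,…,X_{m+1}`
(coordinates `0,…,m` of a path). -/
noncomputable def pathE {D : Type*} [Fintype D] (P : Matrix D D ℝ) (ν : D → ℝ) (m : ℕ)
    (g : (Fin (m + 1) → D) → ℝ) : ℝ :=
  ∑ x : Fin (m + 1) → D, (ν (x 0) * ∏ i : Fin m, P (x i.castSucc) (x i.succ)) * g x

/-- The mean square error `e_ν(S_{n,n₀},f)² = E_{ν,P}|S_{n,n₀}(f) − S(f)|²`, where
`S_{n,n₀}(f) = (1/n) Σ_{j=1}^n f(X_{j+n₀})` and `S(f) = Σ_y f(y) π(y)`. -/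
noncomputable def mse {D : Type*} [Fintype D] (P : Matrix D D ℝ) (π ν f : D → ℝ)
    (n n₀ : ℕ) : ℝ :=
  pathE P ν (n₀ + n) fun x =>
    ((∑ j : Fin n, f (x (Fin.castSucc (Fin.natAdd n₀ j)))) / (n : ℝ) - ∑ y, f y * π y) ^ 2

/-- `W(n,β) = (n(1-β²) - 2β(1-βⁿ))/(1-β)²`. -/
noncomputable def W (n : ℕ) (b : ℝ) : ℝ :=
  ((n : ℝ) * (1 - b ^ 2) - 2 * b * (1 - b ^ n)) / (1 - b) ^ 2

section PathExpectation

variable {D : Type*} [Fintype D] (P : Matrix D D ℝ)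

/-- First-step decomposition of the path expectation. -/
theorem pathE_succ (ν : D → ℝ) (m : ℕ) (g : (Fin (m + 2) → D) → ℝ) :
    pathE P ν (m + 1) g = ∑ x, ν x * pathE P (P x) m fun z => g (Fin.cons x z) := by
  unfold pathE
  rw [← (Fin.consEquiv fun _ : Fin (m + 2) => D).sum_comp, Fintype.sum_prod_type]
  refine sum_congr rfl fun x _ => ?_
  rw [mul_sum]
  refine sum_congr rfl fun z _ => ?_
  simp only [Fin.consEquiv_apply, Fin.prod_univ_succ, Fin.castSucc_zero, Fin.cons_zero,
    Fin.cons_succ, ← Fin.succ_castSucc]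
  exact mul_assoc _ _ _

theorem pathE_add (ν : D → ℝ) (m : ℕ) (g h : (Fin (m + 1) → D) → ℝ) :
    pathE P ν m (fun x => g x + h x) = pathE P ν m g + pathE P ν m h := by
  simp only [pathE, mul_add, sum_add_distrib]

theorem pathE_const_mul (ν : D → ℝ) (m : ℕ) (c : ℝ) (g : (Fin (m + 1) → D) → ℝ) :
    pathE P ν m (fun x => c * g x) = c * pathE P ν m g := by
  simp only [pathE, mul_sum]
  exact sum_congr rfl fun x _ => by ring

/-- The path expectation is linear in the initial distribution. -/
theorem sum_mul_pathE (π : D → ℝ) (m : ℕ) (g : (Fin (m + 1) → D) → ℝ) :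
    ∑ x, π x * pathE P (P x) m g = pathE P (fun y => ∑ x, π x * P x y) m g := by
  simp only [pathE, mul_sum, sum_mul]
  rw [sum_comm]
  exact sum_congr rfl fun z _ => sum_congr rfl fun x _ => by ring

theorem pathE_const (hP1 : ∀ x, ∑ y, P x y = 1) (c : ℝ) (m : ℕ) (ν : D → ℝ) :
    pathE P ν m (fun _ => c) = (∑ x, ν x) * c := by
  induction m generalizing ν with
  | zero =>
    rw [pathE, ← (Equiv.funUnique (Fin 1) D).symm.sum_comp]
    simp [sum_mul]
  | succ m ih =>
    rw [pathE_succ, sum_mul]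
    exact sum_congr rfl fun x _ => by rw [ih, hP1, one_mul]

variable {ι : Type*} (s : Finset ι) (c β : ι → ℝ) (u : ι → D → ℝ) (g : D → ℝ)

/-- First moment of an additive functional in terms of an eigenfunction expansion. -/
theorem pathE_sum_eq (hP1 : ∀ x, ∑ y, P x y = 1)
    (heig : ∀ k x, ∑ y, P x y * u k y = β k * u k x)
    (hg : ∀ x, g x = ∑ k ∈ s, c k * u k x) (m : ℕ) (ν : D → ℝ) :
    pathE P ν m (fun x => ∑ j : Fin m, g (x j.castSucc)) =
      ∑ x, ν x * ∑ k ∈ s, c k * (∑ i ∈ range m, β k ^ i) * u k x := by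
  induction m generalizing ν with
  | zero => simp [pathE]
  | succ m ih =>
    rw [pathE_succ]
    refine sum_congr rfl fun x _ => ?_
    congr 1
    simp only [Fin.sum_univ_succ, Fin.castSucc_zero, Fin.cons_zero, Fin.cons_succ,
      ← Fin.succ_castSucc]
    rw [pathE_add, pathE_const P hP1, ih, hP1, one_mul, hg]
    simp only [mul_sum (s := s)]
    rw [sum_comm, ← sum_add_distrib]
    refine sum_congr rfl fun k _ => ?_
    have h : ∑ y, P x y * (c k * (∑ i ∈ range m, β k ^ i) * u k y) =
        c k * (∑ i ∈ range m, β k ^ i) * (β k * u k x) := by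
      rw [← heig, mul_sum univ]
      exact sum_congr rfl fun y _ => by ring
    rw [h, sum_range_succ']
    simp only [pow_succ, ← sum_mul]
    ring

theorem W_succ (m : ℕ) {b : ℝ} (hb : b ≠ 1) :
    W (m + 1) b = 1 + 2 * (b * ∑ i ∈ range m, b ^ i) + W m b := by
  have h1 : 1 - b ≠ 0 := sub_ne_zero.2 hb.symm
  have h2 : b - 1 ≠ 0 := sub_ne_zero.2 hb
  rw [geom_sum_eq hb, W, W, ← neg_sub 1 b]
  push_cast
  field_simp
  ring

/-- Second moment of an additive functional of the stationary chain. -/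
theorem pathE_sum_sq_eq (π : D → ℝ) (hP1 : ∀ x, ∑ y, P x y = 1)
    (hstat : ∀ y, ∑ x, π x * P x y = π y) [DecidableEq ι]
    (heig : ∀ k x, ∑ y, P x y * u k y = β k * u k x)
    (horth : ∀ k l, (∑ x, u k x * u l x * π x) = if k = l then 1 else 0)
    (hβ : ∀ k ∈ s, β k ≠ 1)
    (hg : ∀ x, g x = ∑ k ∈ s, c k * u k x) (m : ℕ) :
    pathE P π m (fun x => (∑ j : Fin m, g (x j.castSucc)) ^ 2) =
      ∑ k ∈ s, c k ^ 2 * W m (β k) := by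
  have hinner : ∀ d : ι → ℝ, ∑ x, π x * (g x * ∑ k ∈ s, d k * u k x) =
      ∑ k ∈ s, c k * d k := by
    intro d
    calc ∑ x, π x * (g x * ∑ k ∈ s, d k * u k x)
        = ∑ x, ∑ k ∈ s, ∑ l ∈ s, c k * d l * (u k x * u l x * π x) := by
          refine sum_congr rfl fun x _ => ?_
          rw [hg, sum_mul_sum, mul_sum]
          refine sum_congr rfl fun k _ => ?_
          rw [mul_sum]
          exact sum_congr rfl fun l _ => by ring
      _ = ∑ k ∈ s, ∑ l ∈ s, c k * d l * ∑ x, u k x * u l x * π x := by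
          rw [sum_comm]
          refine sum_congr rfl fun k _ => ?_
          rw [sum_comm]
          exact sum_congr rfl fun l _ => by rw [mul_sum]
      _ = ∑ k ∈ s, c k * d k := by
          refine sum_congr rfl fun k hk => ?_
          simp [horth, hk]
  induction m with
  | zero => simp [pathE, W]
  | succ m ih =>
    have hstep : ∀ x, pathE P (P x) m (fun z =>
        (∑ j : Fin (m + 1), g ((Fin.cons x z : Fin (m + 2) → D) j.castSucc)) ^ 2) =
        g x * ∑ k ∈ s, (c k + 2 * (c k * (β k * ∑ i ∈ range m, β k ^ i))) * u k x +
          pathE P (P x) m (fun z => (∑ j : Fin m, g (z j.castSucc)) ^ 2) := by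
      intro x
      simp only [Fin.sum_univ_succ, Fin.castSucc_zero, Fin.cons_zero, Fin.cons_succ,
        ← Fin.succ_castSucc, add_sq]
      rw [pathE_add, pathE_add, pathE_const P hP1, pathE_const_mul,
        pathE_sum_eq P s c β u g hP1 heig hg, hP1, one_mul]
      congr 1
      have h : ∑ y, P x y * ∑ k ∈ s, c k * (∑ i ∈ range m, β k ^ i) * u k y =
          ∑ k ∈ s, c k * (β k * ∑ i ∈ range m, β k ^ i) * u k x := by
        simp only [mul_sum (s := s)]
        rw [sum_comm]
        refine sum_congr rfl fun k _ => ?_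
        calc ∑ y, P x y * (c k * (∑ i ∈ range m, β k ^ i) * u k y)
            = c k * (∑ i ∈ range m, β k ^ i) * ∑ y, P x y * u k y := by
              rw [mul_sum univ]
              exact sum_congr rfl fun y _ => by ring
          _ = _ := by rw [heig]; ring
      rw [h]
      simp only [add_mul, sum_add_distrib, ← hg, mul_assoc, ← mul_sum]
      ring
    rw [pathE_succ]
    simp only [hstep, mul_add (π _), sum_add_distrib]
    rw [hinner, sum_mul_pathE]
    simp only [hstat]
    rw [ih, ← sum_add_distrib]
    refine sum_congr rfl fun k hk => ?_
    rw [W_succ m (hβ k hk)]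
    ring

theorem mse_zero_eq (π ν f : D → ℝ) {n : ℕ} (hn : n ≠ 0) :
    mse P π ν f n 0 = 1 / (n : ℝ) ^ 2 *
      pathE P ν n (fun x => (∑ j : Fin n, (f (x j.castSucc) - ∑ y, f y * π y)) ^ 2) := by
  have hcast : ∀ (m : ℕ) (e : Fin n → Fin m), m = n → (∀ j, (e j : ℕ) = j) →
      pathE P ν m (fun x => ((∑ j, f (x (e j).castSucc)) / (n : ℝ) - ∑ y, f y * π y) ^ 2) =
      pathE P ν n
        (fun x => ((∑ j : Fin n, f (x j.castSucc)) / (n : ℝ) - ∑ y, f y * π y) ^ 2) := by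
    rintro m e rfl he
    have hid : e = id := funext fun j => Fin.ext (he j)
    simp [hid]
  rw [mse, hcast (0 + n) (Fin.natAdd 0) (zero_add n) (by simp), ← pathE_const_mul]
  congr 1
  ext x
  have hn' : (n : ℝ) ≠ 0 := Nat.cast_ne_zero.2 hn
  rw [sum_sub_distrib, sum_const, card_univ, Fintype.card_fin, nsmul_eq_mul]
  field_simp

/-- A `π`-orthonormal family indexed by a type of the cardinality of `D` is complete. -/
theorem sum_inner_mul_eq [Fintype ι] [DecidableEq ι] (π : D → ℝ)
    (hcard : Fintype.card ι = Fintype.card D)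
    (horth : ∀ k l, (∑ x, u k x * u l x * π x) = if k = l then 1 else 0)
    (f : D → ℝ) (x : D) :
    ∑ k, (∑ y, f y * u k y * π y) * u k x = f x := by
  classical
  let A : Matrix ι D ℝ := Matrix.of u
  let B : Matrix D ι ℝ := Matrix.of fun x k => u k x * π x
  have hAB : A * B = 1 := by
    ext k l
    simp only [A, B, Matrix.mul_apply, Matrix.of_apply, Matrix.one_apply, ← mul_assoc, horth]
  have hBA : B * A = 1 := (Matrix.mul_eq_one_comm_of_card_eq ι D ℝ hcard).1 hAB
  have h : ∀ y, ∑ k, u k y * π y * u k x = if y = x then 1 else 0 := fun y => by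
    simpa [A, B, Matrix.mul_apply, Matrix.one_apply] using congrFun (congrFun hBA y) x
  simp only [sum_mul]
  rw [sum_comm]
  simp only [mul_assoc, ← mul_sum] at h ⊢
  simp [h]

end PathExpectation

/-- For an irreducible transition matrix `P` reversible w.r.t. a positive probability
vector `π`, with eigenvalues `1 = β₀ > β₁ ≥ … ≥ β_{|D|−1} ≥ −1` and `π`-orthonormal
eigenbasis `u₀ ≡ 1, u₁, …`, the stationary-start mean square error satisfies
`e_π(S_n,f)² = (1/n²) Σ_{k=1}^{|D|−1} a_k² W(n,β_k)` with `a_k = ⟨f,u_k⟩`. -/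
theorem stmt0 {D : Type*} [Fintype D] [DecidableEq D] [Nonempty D]
    (P : Matrix D D ℝ) (π : D → ℝ)
    (hP0 : ∀ x y, 0 ≤ P x y) (hP1 : ∀ x, ∑ y, P x y = 1)
    (hπpos : ∀ x, 0 < π x) (hπ1 : ∑ x, π x = 1)
    (hrev : ∀ x y, π x * P x y = π y * P y x)
    (hirr : ∀ x y, ∃ k : ℕ, 0 < (P ^ k) x y)
    (β : Fin (Fintype.card D) → ℝ) (u : Fin (Fintype.card D) → D → ℝ)
    (heig : ∀ k x, ∑ y, P x y * u k y = β k * u k x)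
    (horth : ∀ k l, (∑ x, u k x * u l x * π x) = if k = l then 1 else 0)
    (hβ0 : β ⟨0, Fintype.card_pos⟩ = 1)
    (hu0 : ∀ x, u ⟨0, Fintype.card_pos⟩ x = 1)
    (hmono : ∀ k l, k ≤ l → β l ≤ β k)
    (hβtop : ∀ k, k ≠ (⟨0, Fintype.card_pos⟩ : Fin (Fintype.card D)) → β k < 1)
    (hβbot : ∀ k, -1 ≤ β k)
    (f : D → ℝ) (n : ℕ) (hn : 1 ≤ n) :
    mse P π π f n 0 =
      1 / (n : ℝ) ^ 2 *
        ∑ k ∈ Finset.univ.erase (⟨0, Fintype.card_pos⟩ : Fin (Fintype.card D)),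
          (∑ x, f x * u k x * π x) ^ 2 * W n (β k) := by
  have hstat : ∀ y, ∑ x, π x * P x y = π y := fun y => by
    simp only [hrev _ y, ← mul_sum, hP1, mul_one]
  rw [mse_zero_eq P π π f (by omega)]
  congr 1
  refine pathE_sum_sq_eq P (univ.erase ⟨0, Fintype.card_pos⟩)
    (fun k => ∑ x, f x * u k x * π x) β u (fun x => f x - ∑ y, f y * π y) π hP1 hstat heig horth
    (fun k hk => (hβtop k (ne_of_mem_erase hk)).ne) (fun x => ?_) n
  have hx := sum_inner_mul_eq u π (Fintype.card_fin _) horth f x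
  rw [← add_sum_erase _ _ (mem_univ ⟨0, Fintype.card_pos⟩)] at hx
  simp only [hu0, mul_one] at hx
  linarith
end

section
/- For every natural number n ≥ 1, the function x ↦ W(n,x) = (n(1−x²) − 2x(1−xⁿ))/(1−x)² is monotonically increasing on the interval [−1,1), and moreover W(n,x) ≤ 2n/(1−x) for every x ∈ [−1,1). -/
theorem two_mul_one_sub_pow_le {x : ℝ} (hx : |x| ≤ 1) (n : ℕ) :
    2 * (1 - x ^ (n + 1)) ≤ (1 - x) * ((n + 1) * (1 + x ^ n)) := by
  have hpow (k : ℕ) : x ^ k ≤ 1 :=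
    (le_abs_self _).trans (by rw [abs_pow]; exact pow_le_one₀ (abs_nonneg x) hx)
  have hsum : 0 ≤ ∑ k ∈ Finset.range (n + 1), (1 - x ^ k) * (1 - x ^ (n - k)) :=
    Finset.sum_nonneg fun k _ => mul_nonneg (sub_nonneg.2 (hpow _)) (sub_nonneg.2 (hpow _))
  have hterm : ∑ k ∈ Finset.range (n + 1), (1 - x ^ k) * (1 - x ^ (n - k)) =
      ∑ k ∈ Finset.range (n + 1), ((1 + x ^ n) - x ^ k - x ^ (n - k)) := by
    refine Finset.sum_congr rfl fun k hk => ?_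
    rw [← pow_mul_pow_sub x (Nat.lt_succ_iff.1 (Finset.mem_range.1 hk))]
    ring
  have hreflect : ∑ k ∈ Finset.range (n + 1), x ^ (n - k) =
      ∑ k ∈ Finset.range (n + 1), x ^ k := by
    simpa using Finset.sum_range_reflect (fun k => x ^ k) (n + 1)
  rw [hterm, Finset.sum_sub_distrib, Finset.sum_sub_distrib, hreflect, Finset.sum_const,
    Finset.card_range, nsmul_eq_mul] at hsum
  push_cast at hsum
  have hgeom := mul_neg_geom_sum x (n + 1)
  have hmul := mul_nonneg (sub_nonneg.2 (le_of_abs_le hx)) hsum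
  linear_combination hmul - 2 * hgeom

theorem hasDerivAt_W (n : ℕ) {x : ℝ} (hx : x ≠ 1) :
    HasDerivAt (W n)
      (2 * ((1 - x) * ((n + 1) * (1 + x ^ n)) - 2 * (1 - x ^ (n + 1))) / (1 - x) ^ 3) x := by
  have hx' : 1 - x ≠ 0 := sub_ne_zero.2 hx.symm
  have hlin := (hasDerivAt_id x).const_sub 1
  have hnum := (((hasDerivAt_pow 2 x).const_sub 1).const_mul (n : ℝ)).sub
    (((hasDerivAt_id x).const_mul 2).mul ((hasDerivAt_pow n x).const_sub 1))
  have hW := hnum.div (hlin.pow 2) (pow_ne_zero 2 hx')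
  have hn : (n : ℝ) * x ^ (n - 1) * x = n * x ^ n := by
    cases n with
    | zero => simp
    | succ n => rw [Nat.add_sub_cancel]; ring
  refine hW.congr_deriv ?_
  simp only [id, Pi.sub_apply, Pi.mul_apply, Pi.pow_apply]
  field_simp
  push_cast
  linear_combination 2 * (1 - x) ^ 2 * hn

theorem W_le {x : ℝ} (hx : x ∈ Set.Ico (-1 : ℝ) 1) (n : ℕ) : W n x ≤ 2 * n / (1 - x) := by
  obtain ⟨hx₁, hx₂⟩ := hx
  have hpos : 0 < 1 - x := sub_pos.2 hx₂
  have hgeom := mul_neg_geom_sum x n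
  have hbound : 0 ≤ n * (1 - x) + 2 * x * ∑ k ∈ Finset.range n, x ^ k := by
    rcases le_total 0 x with h | h
    · positivity
    · have hle : ∑ k ∈ Finset.range n, x ^ k ≤ n := by
        simpa using Finset.sum_le_card_nsmul (Finset.range n) (fun k => x ^ k) 1 fun k _ =>
          (le_abs_self _).trans
            (by rw [abs_pow]; exact pow_le_one₀ (abs_nonneg x) (abs_le.2 ⟨hx₁, hx₂.le⟩))
      nlinarith [mul_nonneg (neg_nonneg.2 h) (sub_nonneg.2 hle),
        mul_nonneg n.cast_nonneg (neg_le_iff_add_nonneg.1 hx₁)]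
  rw [W, div_le_div_iff₀ (pow_pos hpos 2) hpos]
  have hmul := mul_nonneg (pow_pos hpos 2).le hbound
  linear_combination hmul + 2 * x * (1 - x) * hgeom

/-- For every `n ≥ 1`, the function `x ↦ W(n,x)` is monotonically increasing on `[-1,1)`
and satisfies `W(n,x) ≤ 2n/(1-x)` there. -/
theorem stmt1 (n : ℕ) (hn : 1 ≤ n) :
    MonotoneOn (W n) (Set.Ico (-1 : ℝ) 1) ∧
    ∀ x ∈ Set.Ico (-1 : ℝ) 1, W n x ≤ 2 * n / (1 - x) := by
  refine ⟨monotoneOn_of_deriv_nonneg (convex_Ico _ _)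
    (fun x hx => (hasDerivAt_W n hx.2.ne).continuousAt.continuousWithinAt)
    (fun x hx => (hasDerivAt_W n (interior_subset hx).2.ne).differentiableAt.differentiableWithinAt)
    fun x hx => ?_, fun x hx => W_le hx n⟩
  obtain ⟨hx₁, hx₂⟩ := interior_subset hx
  rw [(hasDerivAt_W n hx₂.ne).deriv]
  exact div_nonneg
    (mul_nonneg zero_le_two (sub_nonneg.2 (two_mul_one_sub_pow_le (abs_le.2 ⟨hx₁, hx₂.le⟩) n)))
    (pow_nonneg (sub_nonneg.2 hx₂.le) 3)
end

section
/- Let P be a transition matrix on a finite set D, reversible with respect to a (positive) probability measure π, with second largest eigenvalue β₁ and second largest absolute eigenvalue β < 1, and let ν be any initial distribution. Then lim_{n→∞} n · sup_{‖f‖₂ ≤ 1} e_ν(S_{n,n₀},f)² = (1+β₁)/(1−β₁), and for every fixed n, lim_{n₀→∞} sup_{‖f‖₂ ≤ 1} e_ν(S_{n,n₀},f)² = (1+β₁)/(n(1−β₁)) − 2β₁(1−β₁ⁿ)/(n²(1−β₁)²). -/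
open Finset

section MarkovPaths

open Matrix

variable {D : Type*} [Fintype D]

/-- Integrating out the last step of a path replaces `h` by `P *ᵥ h`. -/
lemma pathE_succ_init_mul_last (P : Matrix D D ℝ) (ν : D → ℝ) (m : ℕ)
    (G : (Fin (m + 1) → D) → ℝ) (h : D → ℝ) :
    pathE P ν (m + 1) (fun x => G (Fin.init x) * h (x (Fin.last (m + 1)))) =
      pathE P ν m (fun x => G x * (P *ᵥ h) (x (Fin.last m))) := by
  unfold pathE
  rw [← (Fin.snocEquiv (fun _ : Fin (m + 2) => D)).sum_comp, Fintype.sum_prod_type,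
    Finset.sum_comm]
  refine Finset.sum_congr rfl fun x _ => ?_
  simp only [mulVec, dotProduct]
  rw [Finset.mul_sum, Finset.mul_sum]
  refine Finset.sum_congr rfl fun y _ => ?_
  have h0 : (Fin.snoc x y : Fin (m + 2) → D) 0 = x 0 :=
    Fin.snoc_castSucc (α := fun _ => D) y x 0
  have hlast : (Fin.snoc x y : Fin (m + 2) → D) (Fin.last (m + 1)) = y :=
    Fin.snoc_last (α := fun _ => D) y x
  have hc : ∀ i : Fin (m + 1), (Fin.snoc x y : Fin (m + 2) → D) i.castSucc = x i :=
    fun i => Fin.snoc_castSucc (α := fun _ => D) y x i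
  have hi : Fin.init (Fin.snoc x y : Fin (m + 2) → D) = x := funext hc
  change (ν ((Fin.snoc x y : Fin (m + 2) → D) 0) * ∏ i : Fin (m + 1),
      P ((Fin.snoc x y : Fin (m + 2) → D) i.castSucc)
        ((Fin.snoc x y : Fin (m + 2) → D) i.succ)) *
    (G (Fin.init (Fin.snoc x y : Fin (m + 2) → D)) *
      h ((Fin.snoc x y : Fin (m + 2) → D) (Fin.last (m + 1)))) = _
  rw [hi, Fin.prod_univ_castSucc, h0, hlast, Fin.succ_last, hlast, hc]
  simp_rw [Fin.succ_castSucc, hc]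
  ring

lemma pathE_sum {ι : Type*} (P : Matrix D D ℝ) (ν : D → ℝ) (m : ℕ) (s : Finset ι)
    (g : ι → (Fin (m + 1) → D) → ℝ) :
    pathE P ν m (fun x => ∑ i ∈ s, g i x) = ∑ i ∈ s, pathE P ν m (g i) := by
  unfold pathE
  simp_rw [Finset.mul_sum]
  exact Finset.sum_comm

lemma pathE_mul_const (P : Matrix D D ℝ) (ν : D → ℝ) (m : ℕ)
    (g : (Fin (m + 1) → D) → ℝ) (c : ℝ) :
    pathE P ν m (fun x => g x * c) = pathE P ν m g * c := by
  unfold pathE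
  simp_rw [Finset.sum_mul, mul_assoc]

variable [DecidableEq D]

lemma pathE_last (P : Matrix D D ℝ) (ν : D → ℝ) (m : ℕ) (h : D → ℝ) :
    pathE P ν m (fun x => h (x (Fin.last m))) = ν ⬝ᵥ (P ^ m *ᵥ h) := by
  induction m generalizing h with
  | zero =>
    unfold pathE
    rw [← (Equiv.funUnique (Fin 1) D).symm.sum_comp]
    simp [dotProduct]
  | succ m ih =>
    have := pathE_succ_init_mul_last P ν m (fun _ => 1) h
    simp only [one_mul] at this
    rw [this, ih, pow_succ, mulVec_mulVec]

/-- Two-point expectations of a Markov chain. -/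
lemma pathE_two_point (P : Matrix D D ℝ) (hP1 : ∀ x, ∑ y, P x y = 1) (ν : D → ℝ) (m : ℕ)
    (g h : D → ℝ) (s t : Fin (m + 1)) (hst : s ≤ t) :
    pathE P ν m (fun x => g (x s) * h (x t)) =
      ν ⬝ᵥ (P ^ (s : ℕ) *ᵥ (g * (P ^ ((t : ℕ) - s) *ᵥ h))) := by
  induction m generalizing h with
  | zero =>
    obtain rfl : s = Fin.last 0 := Fin.ext (by simp)
    obtain rfl : t = Fin.last 0 := Fin.ext (by simp)
    have := pathE_last P ν 0 (g * h)
    simpa using this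
  | succ m ih =>
    have hone : P *ᵥ (fun _ => (1 : ℝ)) = fun _ => 1 := by
      ext x; simp [mulVec, dotProduct, hP1]
    induction t using Fin.lastCases with
    | last =>
      induction s using Fin.lastCases with
      | last =>
        have := pathE_last P ν (m + 1) (g * h)
        simpa using this
      | cast s =>
        have := pathE_succ_init_mul_last P ν m (fun x => g (x s)) h
        simp only [Fin.init] at this
        rw [this, ih (P *ᵥ h) s (Fin.last m) (Fin.le_last s), mulVec_mulVec, ← pow_succ]
        have : (s : ℕ) ≤ m := Nat.lt_succ_iff.mp s.2
        simp [Nat.succ_sub this]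
    | cast t =>
      have hs : (s : ℕ) < m + 1 := lt_of_le_of_lt (Fin.le_def.mp hst) t.2
      obtain ⟨s, rfl⟩ : ∃ s' : Fin (m + 1), s = s'.castSucc := ⟨⟨s, hs⟩, rfl⟩
      have := pathE_succ_init_mul_last P ν m (fun x => g (x s) * h (x t)) (fun _ => 1)
      simp only [Fin.init, hone, mul_one] at this
      rw [this, ih h s t (by simpa using hst)]
      simp

/-- The mean square error as a double sum of covariances of the centred integrand. -/
lemma mse_eq_sum (P : Matrix D D ℝ) (hP1 : ∀ x, ∑ y, P x y = 1) (π ν f g : D → ℝ)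
    (hg : ∀ x, g x = f x - ∑ y, f y * π y) (n n₀ : ℕ) (hn : n ≠ 0) :
    mse P π ν f n n₀ = (∑ i ∈ range n, ∑ j ∈ range n,
      ν ⬝ᵥ (P ^ (n₀ + min i j) *ᵥ (g * (P ^ (max i j - min i j) *ᵥ g)))) / (n : ℝ) ^ 2 := by
  have hn' : (n : ℝ) ≠ 0 := by exact_mod_cast hn
  have key : ∀ x : Fin (n₀ + n + 1) → D,
      ((∑ j : Fin n, f (x (Fin.castSucc (Fin.natAdd n₀ j)))) / (n : ℝ) - ∑ y, f y * π y) ^ 2 =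
      (∑ i : Fin n, ∑ j : Fin n, g (x (Fin.castSucc (Fin.natAdd n₀ i))) *
        g (x (Fin.castSucc (Fin.natAdd n₀ j)))) * ((n : ℝ) ^ 2)⁻¹ := by
    intro x
    rw [← Finset.sum_mul_sum, ← sq]
    simp_rw [hg]
    rw [Finset.sum_sub_distrib]
    simp only [Finset.sum_const, Finset.card_univ, Fintype.card_fin, nsmul_eq_mul]
    field_simp
  unfold mse
  simp_rw [key]
  rw [pathE_mul_const, pathE_sum, ← div_eq_mul_inv]
  simp_rw [pathE_sum, Finset.sum_range]
  congr 1
  refine Finset.sum_congr rfl fun i _ => Finset.sum_congr rfl fun j _ => ?_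
  rcases le_total (i : ℕ) j with hij | hij
  · rw [pathE_two_point P hP1 _ _ _ _ _ _
      (Fin.le_def.mpr (by simpa using hij))]
    simp [min_eq_left hij, max_eq_right hij, Nat.add_sub_add_left]
  · rw [show (fun x : Fin (n₀ + n + 1) → D => g (x (Fin.natAdd n₀ i).castSucc) *
        g (x (Fin.natAdd n₀ j).castSucc)) = fun x => g (x (Fin.natAdd n₀ j).castSucc) *
        g (x (Fin.natAdd n₀ i).castSucc) from funext fun x => mul_comm _ _,
      pathE_two_point P hP1 _ _ _ _ _ _ (Fin.le_def.mpr (by simpa using hij))]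
    simp [min_eq_right hij, max_eq_left hij, Nat.add_sub_add_left]

end MarkovPaths

section LagSum

/-- The sum of `y ^ |i - j|` over all `i, j < n`. -/
noncomputable def lagSum (n : ℕ) (y : ℝ) : ℝ :=
  ∑ i ∈ range n, ∑ j ∈ range n, y ^ (max i j - min i j)

lemma lagSum_succ (n : ℕ) (y : ℝ) :
    lagSum (n + 1) y = lagSum n y + (1 + 2 * ∑ j ∈ range n, y ^ (j + 1)) := by
  have h1 : ∑ i ∈ range n, y ^ (max i n - min i n) = ∑ j ∈ range n, y ^ (j + 1) := by
    rw [← Finset.sum_range_reflect]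
    refine Finset.sum_congr rfl fun i hi => ?_
    have := Finset.mem_range.mp hi
    congr 1
    omega
  have h2 : ∑ i ∈ range n, y ^ (max n i - min n i) = ∑ j ∈ range n, y ^ (j + 1) := by
    simp_rw [max_comm n, min_comm n]
    exact h1
  unfold lagSum
  rw [Finset.sum_range_succ]
  simp_rw [Finset.sum_range_succ]
  rw [Finset.sum_add_distrib, h1, h2]
  simp
  ring

lemma lagSum_eq_sum (n : ℕ) (y : ℝ) :
    lagSum n y = ∑ m ∈ range n, (1 + 2 * ∑ j ∈ range m, y ^ (j + 1)) := by
  induction n with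
  | zero => simp [lagSum]
  | succ n ih => rw [lagSum_succ, ih, Finset.sum_range_succ]

lemma lagSum_mul_one_sub_sq (n : ℕ) (y : ℝ) :
    lagSum n y * (1 - y) ^ 2 = n * (1 - y ^ 2) - 2 * y * (1 - y ^ n) := by
  induction n with
  | zero => simp [lagSum]
  | succ n ih =>
    have hg : (∑ j ∈ range n, y ^ (j + 1)) * (1 - y) = y * (1 - y ^ n) := by
      have := geom_sum_mul y n
      simp_rw [pow_succ]
      rw [← Finset.sum_mul]
      linear_combination -y * this
    rw [lagSum_succ, add_mul, ih]
    push_cast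
    linear_combination 2 * (1 - y) * hg

lemma sum_succ_mul_pow_mul_one_sub_sq (m : ℕ) (y : ℝ) :
    (∑ j ∈ range m, ((j : ℝ) + 1) * y ^ j) * (1 - y) ^ 2 =
      1 - (m + 1) * y ^ m + m * y ^ (m + 1) := by
  induction m with
  | zero => simp
  | succ m ih =>
    rw [Finset.sum_range_succ, add_mul, ih]
    push_cast
    ring

lemma sum_sum_succ_mul_pow_mul_one_sub_sq (n : ℕ) (y : ℝ) :
    (∑ m ∈ range (n + 1), ∑ j ∈ range m, ((j : ℝ) + 1) * y ^ j) * (1 - y) ^ 2 =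
      n * (1 + y ^ (n + 1)) - 2 * ∑ j ∈ range n, y ^ (j + 1) := by
  induction n with
  | zero => simp
  | succ n ih =>
    rw [Finset.sum_range_succ, add_mul, ih, sum_succ_mul_pow_mul_one_sub_sq,
      Finset.sum_range_succ _ n]
    push_cast
    ring

lemma two_mul_sum_pow_le (n : ℕ) {y : ℝ} (hy : |y| ≤ 1) :
    2 * ∑ j ∈ range n, y ^ (j + 1) ≤ n * (1 + y ^ (n + 1)) := by
  have hpow : ∀ k : ℕ, y ^ k ≤ 1 := fun k =>
    (le_abs_self _).trans (by rw [abs_pow]; exact pow_le_one₀ (abs_nonneg y) hy)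
  have hrefl : 2 * ∑ j ∈ range n, y ^ (j + 1) =
      ∑ j ∈ range n, (y ^ (j + 1) + y ^ (n - j)) := by
    rw [Finset.sum_add_distrib, two_mul, add_right_inj, ← Finset.sum_range_reflect]
    refine Finset.sum_congr rfl fun i hi => ?_
    have := Finset.mem_range.mp hi
    congr 1
    omega
  have hconst : (n : ℝ) * (1 + y ^ (n + 1)) = ∑ _j ∈ range n, (1 + y ^ (n + 1)) := by
    rw [Finset.sum_const, Finset.card_range, nsmul_eq_mul]
  rw [hrefl, hconst]
  refine Finset.sum_le_sum fun j hj => ?_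
  have hj' := Finset.mem_range.mp hj
  have hsplit : y ^ (n + 1) = y ^ (j + 1) * y ^ (n - j) := by
    rw [← pow_add]; congr 1; omega
  rw [hsplit]
  nlinarith [mul_nonneg (sub_nonneg.mpr (hpow (j + 1))) (sub_nonneg.mpr (hpow (n - j)))]

lemma hasDerivAt_lagSum (n : ℕ) (y : ℝ) :
    HasDerivAt (lagSum n) (2 * ∑ m ∈ range n, ∑ j ∈ range m, ((j : ℝ) + 1) * y ^ j) y := by
  have hfun : lagSum n = fun y => ∑ m ∈ range n, (1 + 2 * ∑ j ∈ range m, y ^ (j + 1)) :=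
    funext (lagSum_eq_sum n)
  rw [hfun, Finset.mul_sum]
  refine HasDerivAt.fun_sum fun m _ => ?_
  refine HasDerivAt.const_add _ (HasDerivAt.const_mul _ (HasDerivAt.fun_sum fun j _ => ?_))
  simpa using hasDerivAt_pow (j + 1) y

lemma monotoneOn_lagSum (n : ℕ) : MonotoneOn (lagSum n) (Set.Icc (-1) 1) := by
  refine monotoneOn_of_deriv_nonneg (convex_Icc _ _)
    (fun y _ => (hasDerivAt_lagSum n y).continuousAt.continuousWithinAt)
    (fun y _ => (hasDerivAt_lagSum n y).differentiableAt.differentiableWithinAt)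
    fun y hy => ?_
  rw [interior_Icc] at hy
  rw [(hasDerivAt_lagSum n y).deriv]
  cases n with
  | zero => simp
  | succ n =>
    have hpos : 0 < (1 - y) ^ 2 := by
      have := sub_pos.mpr hy.2
      positivity
    have h := sum_sum_succ_mul_pow_mul_one_sub_sq n y
    have h' := two_mul_sum_pow_le n (abs_le.mpr ⟨hy.1.le, hy.2.le⟩)
    have : 0 ≤ ∑ m ∈ range (n + 1), ∑ j ∈ range m, ((j : ℝ) + 1) * y ^ j :=
      nonneg_of_mul_nonneg_left (by rw [h]; linarith) hpos
    linarith

lemma lagSum_nonneg (n : ℕ) {y : ℝ} (hy : y ∈ Set.Icc (-1 : ℝ) 1) : 0 ≤ lagSum n y := by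
  have h1 := monotoneOn_lagSum n (Set.left_mem_Icc.mpr (by norm_num)) hy hy.1
  have h2 := lagSum_mul_one_sub_sq n (-1)
  have h3 : (-1 : ℝ) ^ n ≤ 1 := by
    rcases neg_one_pow_eq_or ℝ n with h | h <;> rw [h]; norm_num
  nlinarith

/-- Geometric decay in `max i j` is summable over pairs, uniformly in the range. -/
lemma sum_sum_pow_max_le (n : ℕ) {b : ℝ} (hb0 : 0 ≤ b) (hb1 : b < 1) :
    ∑ i ∈ range n, ∑ j ∈ range n, b ^ max i j ≤ ((1 - √b)⁻¹) ^ 2 := by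
  have hr0 : 0 ≤ √b := Real.sqrt_nonneg b
  have hr1 : √b < 1 := by rw [Real.sqrt_lt' one_pos]; simpa using hb1
  have hle : ∀ i j : ℕ, b ^ max i j ≤ √b ^ i * √b ^ j := by
    intro i j
    calc b ^ max i j = √b ^ (2 * max i j) := by rw [pow_mul, Real.sq_sqrt hb0]
      _ ≤ √b ^ (i + j) := pow_le_pow_of_le_one hr0 hr1.le (by omega)
      _ = _ := pow_add _ _ _
  have hgeo : ∑ i ∈ range n, √b ^ i ≤ (1 - √b)⁻¹ := by
    rw [← tsum_geometric_of_lt_one hr0 hr1]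
    exact (summable_geometric_of_lt_one hr0 hr1).sum_le_tsum _ fun i _ => by positivity
  calc _ ≤ ∑ i ∈ range n, ∑ j ∈ range n, √b ^ i * √b ^ j :=
        Finset.sum_le_sum fun i _ => Finset.sum_le_sum fun j _ => hle i j
    _ = (∑ i ∈ range n, √b ^ i) ^ 2 := by rw [← Finset.sum_mul_sum, sq]
    _ ≤ _ := pow_le_pow_left₀ (Finset.sum_nonneg fun i _ => by positivity) hgeo 2

end LagSum

section Spectral

open Matrix

variable {D ι : Type*} [Fintype D] [Fintype ι]

/-- The coefficient of `h` along `v` in `L²(π)`. -/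
def piCoeff (π v h : D → ℝ) : ℝ := ∑ x, h x * v x * π x

lemma pow_mulVec_eigenvector [DecidableEq D] {P : Matrix D D ℝ} {v : D → ℝ} {c : ℝ}
    (h : ∀ x, ∑ y, P x y * v y = c * v x) (d : ℕ) : P ^ d *ᵥ v = c ^ d • v := by
  have h1 : P *ᵥ v = c • v := by
    ext x
    simpa [mulVec, dotProduct] using h x
  induction d with
  | zero => simp
  | succ d ih => rw [pow_succ, ← mulVec_mulVec, h1, mulVec_smul, ih, smul_smul, pow_succ']

lemma piCoeff_sum_smul (π v : D → ℝ) (c : ι → ℝ) (w : ι → D → ℝ) :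
    piCoeff π v (∑ k, c k • w k) = ∑ k, c k * piCoeff π v (w k) := by
  simp only [piCoeff, Finset.sum_apply, Pi.smul_apply, smul_eq_mul, Finset.sum_mul,
    Finset.mul_sum]
  rw [Finset.sum_comm]
  exact Finset.sum_congr rfl fun k _ => Finset.sum_congr rfl fun x _ => by ring

lemma piCoeff_centered {κ : Type*} [DecidableEq κ] {π : D → ℝ} {u : κ → D → ℝ}
    (horth : ∀ k l, (∑ x, u k x * u l x * π x) = if k = l then 1 else 0)
    {o : κ} (huo : ∀ x, u o x = 1) (f : D → ℝ) (k : κ) :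
    piCoeff π (u k) (fun x => f x - ∑ y, f y * π y) =
      if k = o then 0 else piCoeff π (u k) f := by
  have h1 : ∑ x, u k x * π x = if k = o then 1 else 0 := by
    rw [← horth k o]
    exact Finset.sum_congr rfl fun x _ => by rw [huo, mul_one]
  have h2 : piCoeff π (u k) (fun x => f x - ∑ y, f y * π y) =
      piCoeff π (u k) f - (∑ y, f y * π y) * ∑ x, u k x * π x := by
    simp only [piCoeff]
    rw [Finset.mul_sum, ← Finset.sum_sub_distrib]
    exact Finset.sum_congr rfl fun x _ => by ring
  rw [h2, h1]
  split_ifs with hk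
  · subst hk
    simp [piCoeff, huo]
  · simp

variable [DecidableEq ι]

/-- An orthonormal family of full cardinality is complete. -/
lemma eq_sum_piCoeff_smul (hcard : Fintype.card ι = Fintype.card D) {π : D → ℝ}
    {u : ι → D → ℝ} (horth : ∀ k l, (∑ x, u k x * u l x * π x) = if k = l then 1 else 0)
    (h : D → ℝ) : h = ∑ k, piCoeff π (u k) h • u k := by
  classical
  have hAB : (of fun k x => u k x * π x : Matrix ι D ℝ) * (of fun x k => u k x) = 1 := by
    ext k l
    rw [mul_apply, one_apply, ← horth k l]
    exact Finset.sum_congr rfl fun x _ => by simp only [of_apply]; ring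
  have hBA := (mul_eq_one_comm_of_card_eq _ _ _ hcard).mp hAB
  ext y
  have hy : ∀ x, ∑ k, u k y * (u k x * π x) = if y = x then 1 else 0 := fun x => by
    have := congrFun (congrFun hBA y) x
    simpa [mul_apply, one_apply] using this
  simp only [Finset.sum_apply, Pi.smul_apply, smul_eq_mul, piCoeff, Finset.sum_mul]
  rw [Finset.sum_comm]
  have : ∀ x, ∑ k, h x * u k x * π x * u k y = h x * if y = x then 1 else 0 := fun x => by
    rw [← hy x, Finset.mul_sum]
    exact Finset.sum_congr rfl fun k _ => by ring
  simp [this]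

lemma pow_mulVec_eq_sum [DecidableEq D] (hcard : Fintype.card ι = Fintype.card D)
    {P : Matrix D D ℝ} {π : D → ℝ} {β : ι → ℝ} {u : ι → D → ℝ}
    (heig : ∀ k x, ∑ y, P x y * u k y = β k * u k x)
    (horth : ∀ k l, (∑ x, u k x * u l x * π x) = if k = l then 1 else 0)
    (d : ℕ) (h : D → ℝ) : P ^ d *ᵥ h = ∑ k, (piCoeff π (u k) h * β k ^ d) • u k := by
  conv_lhs => rw [eq_sum_piCoeff_smul hcard horth h]
  rw [mulVec_sum]
  refine Finset.sum_congr rfl fun k _ => ?_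
  rw [mulVec_smul, pow_mulVec_eigenvector (heig k), smul_smul]

/-- Parseval's identity. -/
lemma sum_piCoeff_sq (hcard : Fintype.card ι = Fintype.card D) {π : D → ℝ}
    {u : ι → D → ℝ} (horth : ∀ k l, (∑ x, u k x * u l x * π x) = if k = l then 1 else 0)
    (h : D → ℝ) : ∑ k, piCoeff π (u k) h ^ 2 = ∑ x, h x ^ 2 * π x := by
  have h1 : ∑ x, h x ^ 2 * π x = piCoeff π h h :=
    Finset.sum_congr rfl fun x _ => by ring
  have h2 : ∀ k, piCoeff π h (u k) = piCoeff π (u k) h := fun k =>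
    Finset.sum_congr rfl fun x _ => by ring
  rw [h1]
  conv_rhs => rw [show piCoeff π h h = piCoeff π h (∑ k, piCoeff π (u k) h • u k) by
    rw [← eq_sum_piCoeff_smul hcard horth h]]
  rw [piCoeff_sum_smul]
  exact Finset.sum_congr rfl fun k _ => by rw [h2]; ring

/-- Covariances of the chain started in `ν` approach the stationary ones geometrically. -/
lemma abs_cov_sub_le [DecidableEq D] (hcard : Fintype.card ι = Fintype.card D)
    {P : Matrix D D ℝ} {π ν : D → ℝ} {β : ι → ℝ} {u : ι → D → ℝ}
    (heig : ∀ k x, ∑ y, P x y * u k y = β k * u k x)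
    (horth : ∀ k l, (∑ x, u k x * u l x * π x) = if k = l then 1 else 0)
    (hν1 : ∑ x, ν x = 1) {o : ι} (hβo : β o = 1) (huo : ∀ x, u o x = 1) {b : ℝ}
    (hb0 : 0 ≤ b) (hb : ∀ k, k ≠ o → |β k| ≤ b) {g : D → ℝ} (hgo : piCoeff π (u o) g = 0)
    (hg : ∀ k, |piCoeff π (u k) g| ≤ 1) (s d : ℕ) :
    |ν ⬝ᵥ (P ^ s *ᵥ (g * (P ^ d *ᵥ g))) - ∑ l, β l ^ d * piCoeff π (u l) g ^ 2| ≤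
      (∑ k, ∑ l, ∑ m, |piCoeff π (u k) (u l * u m) * (ν ⬝ᵥ u k)|) * b ^ (s + d) := by
  set a : ι → ℝ := fun k => piCoeff π (u k) g with ha
  have hprod : g * (P ^ d *ᵥ g) = ∑ l, ∑ m, (a l * β l ^ d * a m) • (u l * u m) := by
    conv_lhs => rw [pow_mulVec_eq_sum hcard heig horth d g]
    conv_lhs => enter [1]; rw [eq_sum_piCoeff_smul hcard horth g]
    rw [Finset.sum_mul_sum, Finset.sum_comm]
    refine Finset.sum_congr rfl fun l _ => Finset.sum_congr rfl fun m _ => ?_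
    ext x
    simp only [Pi.mul_apply, Pi.smul_apply, smul_eq_mul, ha]
    ring
  have hcoef : ∀ k, piCoeff π (u k) (g * (P ^ d *ᵥ g)) =
      ∑ l, ∑ m, a l * β l ^ d * a m * piCoeff π (u k) (u l * u m) := by
    intro k
    have hone : ∑ l, ∑ m, (a l * β l ^ d * a m) • (u l * u m) =
        ∑ l, (1 : ℝ) • ∑ m, (a l * β l ^ d * a m) • (u l * u m) := by simp only [one_smul]
    rw [hprod, hone, piCoeff_sum_smul]
    simp only [one_mul, piCoeff_sum_smul]
  have hcov : ν ⬝ᵥ (P ^ s *ᵥ (g * (P ^ d *ᵥ g))) =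
      ∑ k, piCoeff π (u k) (g * (P ^ d *ᵥ g)) * β k ^ s * (ν ⬝ᵥ u k) := by
    rw [pow_mulVec_eq_sum hcard heig horth s, dotProduct_sum]
    simp_rw [dotProduct_smul, smul_eq_mul]
  have hνo : ν ⬝ᵥ u o = 1 := by simp [dotProduct, huo, hν1]
  have hstat : piCoeff π (u o) (g * (P ^ d *ᵥ g)) = ∑ l, β l ^ d * a l ^ 2 := by
    rw [hcoef]
    refine Finset.sum_congr rfl fun l _ => ?_
    have hT : ∀ m, piCoeff π (u o) (u l * u m) = if l = m then 1 else 0 := fun m => by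
      rw [← horth l m]
      exact Finset.sum_congr rfl fun x _ => by simp [huo]
    simp only [hT, mul_ite, mul_one, mul_zero, Finset.sum_ite_eq, Finset.mem_univ, if_true]
    ring
  have hdiff : ν ⬝ᵥ (P ^ s *ᵥ (g * (P ^ d *ᵥ g))) - ∑ l, β l ^ d * a l ^ 2 =
      ∑ k ∈ univ.erase o, ∑ l, ∑ m, a l * β l ^ d * a m * β k ^ s *
        (piCoeff π (u k) (u l * u m) * (ν ⬝ᵥ u k)) := by
    rw [hcov, ← Finset.add_sum_erase _ _ (Finset.mem_univ o), hβo, hνo, hstat]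
    simp only [one_pow, mul_one, add_sub_cancel_left]
    refine Finset.sum_congr rfl fun k _ => ?_
    rw [hcoef]
    simp_rw [Finset.sum_mul]
    exact Finset.sum_congr rfl fun l _ => Finset.sum_congr rfl fun m _ => by ring
  rw [hdiff]
  have hterm : ∀ k, k ≠ o → ∀ l m, |a l * β l ^ d * a m * β k ^ s *
      (piCoeff π (u k) (u l * u m) * (ν ⬝ᵥ u k))| ≤
      |piCoeff π (u k) (u l * u m) * (ν ⬝ᵥ u k)| * b ^ (s + d) := by
    intro k hk l m
    by_cases hl : l = o
    · have : a l = 0 := by rw [hl]; exact hgo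
      rw [this]
      simp only [zero_mul, abs_zero]
      positivity
    · have h1 : |a l * β l ^ d * a m * β k ^ s| ≤ b ^ (s + d) := by
        rw [abs_mul, abs_mul, abs_mul, abs_pow, abs_pow]
        calc |a l| * |β l| ^ d * |a m| * |β k| ^ s ≤ 1 * b ^ d * 1 * b ^ s := by
              gcongr
              · exact hg l
              · exact hb l hl
              · exact hg m
              · exact hb k hk
          _ = b ^ (s + d) := by rw [pow_add]; ring
      rw [abs_mul, mul_comm]
      exact mul_le_mul_of_nonneg_left h1 (abs_nonneg _)
  calc _ ≤ ∑ k ∈ univ.erase o, ∑ l, ∑ m, |a l * β l ^ d * a m * β k ^ s *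
        (piCoeff π (u k) (u l * u m) * (ν ⬝ᵥ u k))| := by
        refine (Finset.abs_sum_le_sum_abs _ _).trans (Finset.sum_le_sum fun k _ => ?_)
        refine (Finset.abs_sum_le_sum_abs _ _).trans (Finset.sum_le_sum fun l _ => ?_)
        exact Finset.abs_sum_le_sum_abs _ _
    _ ≤ ∑ k ∈ univ.erase o, ∑ l, ∑ m,
        |piCoeff π (u k) (u l * u m) * (ν ⬝ᵥ u k)| * b ^ (s + d) :=
        Finset.sum_le_sum fun k hk => Finset.sum_le_sum fun l _ => Finset.sum_le_sum fun m _ =>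
          hterm k (Finset.ne_of_mem_erase hk) l m
    _ = (∑ k ∈ univ.erase o, ∑ l, ∑ m,
        |piCoeff π (u k) (u l * u m) * (ν ⬝ᵥ u k)|) * b ^ (s + d) := by
        simp_rw [Finset.sum_mul]
    _ ≤ _ := by
        refine mul_le_mul_of_nonneg_right (Finset.sum_le_sum_of_subset_of_nonneg
          (Finset.subset_univ _) fun k _ _ => ?_) (pow_nonneg hb0 _)
        positivity

/-- The mean square error differs from the stationary one by a geometrically small term,
uniformly over the unit ball. -/
lemma abs_mse_sub_le [DecidableEq D] (hcard : Fintype.card ι = Fintype.card D)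
    {P : Matrix D D ℝ} (hP1 : ∀ x, ∑ y, P x y = 1) {π ν : D → ℝ} {β : ι → ℝ} {u : ι → D → ℝ}
    (heig : ∀ k x, ∑ y, P x y * u k y = β k * u k x)
    (horth : ∀ k l, (∑ x, u k x * u l x * π x) = if k = l then 1 else 0)
    (hν1 : ∑ x, ν x = 1) {o : ι} (hβo : β o = 1) (huo : ∀ x, u o x = 1) {b : ℝ}
    (hb0 : 0 ≤ b) (hb1 : b < 1) (hb : ∀ k, k ≠ o → |β k| ≤ b) {f : D → ℝ}
    (hf : ∑ x, f x ^ 2 * π x ≤ 1) {n : ℕ} (hn : n ≠ 0) (n₀ : ℕ) :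
    |mse P π ν f n n₀ -
        (∑ k ∈ univ.erase o, lagSum n (β k) * piCoeff π (u k) f ^ 2) / (n : ℝ) ^ 2| ≤
      (∑ k, ∑ l, ∑ m, |piCoeff π (u k) (u l * u m) * (ν ⬝ᵥ u k)|) * ((1 - √b)⁻¹) ^ 2 *
        b ^ n₀ / (n : ℝ) ^ 2 := by
  set g : D → ℝ := fun x => f x - ∑ y, f y * π y with hgdef
  set K := ∑ k, ∑ l, ∑ m, |piCoeff π (u k) (u l * u m) * (ν ⬝ᵥ u k)| with hK
  have hK0 : 0 ≤ K := by positivity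
  have hcoef : ∀ k, piCoeff π (u k) g = if k = o then 0 else piCoeff π (u k) f :=
    piCoeff_centered horth huo f
  have hf1 : ∀ k, |piCoeff π (u k) f| ≤ 1 := fun k => by
    rw [← sq_le_one_iff_abs_le_one]
    refine le_trans ?_ ((sum_piCoeff_sq hcard horth f).trans_le hf)
    exact Finset.single_le_sum (f := fun k => piCoeff π (u k) f ^ 2)
      (fun k _ => sq_nonneg _) (Finset.mem_univ k)
  have hg1 : ∀ k, |piCoeff π (u k) g| ≤ 1 := fun k => by
    rw [hcoef]
    split_ifs
    · simp
    · exact hf1 k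
  have hgo : piCoeff π (u o) g = 0 := by simp [hcoef]
  have hstat : ∑ k ∈ univ.erase o, lagSum n (β k) * piCoeff π (u k) f ^ 2 =
      ∑ i ∈ range n, ∑ j ∈ range n,
        ∑ l, β l ^ (max i j - min i j) * piCoeff π (u l) g ^ 2 := by
    have h1 : ∑ k, lagSum n (β k) * piCoeff π (u k) g ^ 2 =
        ∑ k ∈ univ.erase o, lagSum n (β k) * piCoeff π (u k) f ^ 2 := by
      rw [← Finset.add_sum_erase _ _ (Finset.mem_univ o), hgo]
      simp only [ne_eq, OfNat.ofNat_ne_zero, not_false_eq_true, zero_pow, mul_zero, zero_add]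
      exact Finset.sum_congr rfl fun k hk => by
        rw [hcoef, if_neg (Finset.ne_of_mem_erase hk)]
    rw [← h1]
    simp only [lagSum, Finset.sum_mul]
    rw [Finset.sum_comm]
    exact Finset.sum_congr rfl fun i _ => Finset.sum_comm
  rw [mse_eq_sum P hP1 π ν f g (fun _ => rfl) n n₀ hn, ← sub_div, abs_div, hstat,
    abs_of_nonneg (sq_nonneg (n : ℝ))]
  gcongr
  simp_rw [← Finset.sum_sub_distrib]
  calc _ ≤ ∑ i ∈ range n, ∑ j ∈ range n, K * b ^ (n₀ + min i j + (max i j - min i j)) := by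
        refine (Finset.abs_sum_le_sum_abs _ _).trans (Finset.sum_le_sum fun i _ => ?_)
        refine (Finset.abs_sum_le_sum_abs _ _).trans (Finset.sum_le_sum fun j _ => ?_)
        exact abs_cov_sub_le hcard heig horth hν1 hβo huo hb0 hb hgo hg1 _ _
    _ = K * b ^ n₀ * ∑ i ∈ range n, ∑ j ∈ range n, b ^ max i j := by
        simp_rw [Finset.mul_sum]
        refine Finset.sum_congr rfl fun i _ => Finset.sum_congr rfl fun j _ => ?_
        rw [mul_assoc, ← pow_add]
        congr 2
        have : min i j ≤ max i j := min_le_max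
        omega
    _ ≤ K * b ^ n₀ * ((1 - √b)⁻¹) ^ 2 := by
        gcongr
        exact sum_sum_pow_max_le n hb0 hb1
    _ = _ := by ring

/-- The worst-case error over the unit ball is the stationary one of the second
eigenvalue `β i₁`, up to a geometrically small term. -/
lemma exists_abs_sSup_mse_sub_le [DecidableEq D] (hcard : Fintype.card ι = Fintype.card D)
    {P : Matrix D D ℝ} (hP1 : ∀ x, ∑ y, P x y = 1) {π ν : D → ℝ} {β : ι → ℝ} {u : ι → D → ℝ}
    (heig : ∀ k x, ∑ y, P x y * u k y = β k * u k x)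
    (horth : ∀ k l, (∑ x, u k x * u l x * π x) = if k = l then 1 else 0)
    (hν1 : ∑ x, ν x = 1) {o i₁ : ι} (hβo : β o = 1) (huo : ∀ x, u o x = 1) (hi₁ : i₁ ≠ o)
    (hmax : ∀ k, k ≠ o → β k ≤ β i₁) {b : ℝ}
    (hb0 : 0 ≤ b) (hb1 : b < 1) (hb : ∀ k, k ≠ o → |β k| ≤ b) :
    ∃ C : ℝ, ∀ n n₀ : ℕ, n ≠ 0 →
      |sSup {r : ℝ | ∃ f : D → ℝ, √(∑ x, f x ^ 2 * π x) ≤ 1 ∧ r = mse P π ν f n n₀} -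
        lagSum n (β i₁) / (n : ℝ) ^ 2| ≤ C * b ^ n₀ / (n : ℝ) ^ 2 := by
  refine ⟨(∑ k, ∑ l, ∑ m, |piCoeff π (u k) (u l * u m) * (ν ⬝ᵥ u k)|) *
    ((1 - √b)⁻¹) ^ 2, fun n n₀ hn => ?_⟩
  have hmse := fun (f : D → ℝ) (hf : ∑ x, f x ^ 2 * π x ≤ 1) =>
    abs_le.mp (abs_mse_sub_le hcard hP1 heig horth hν1 hβo huo hb0 hb1 hb hf hn n₀)
  have hIcc : ∀ k, k ≠ o → β k ∈ Set.Icc (-1 : ℝ) 1 := fun k hk =>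
    abs_le.mp ((hb k hk).trans hb1.le)
  set ε := (∑ k, ∑ l, ∑ m, |piCoeff π (u k) (u l * u m) * (ν ⬝ᵥ u k)|) *
    ((1 - √b)⁻¹) ^ 2 * b ^ n₀ / (n : ℝ) ^ 2 with hε
  set s := {r : ℝ | ∃ f : D → ℝ, √(∑ x, f x ^ 2 * π x) ≤ 1 ∧ r = mse P π ν f n n₀} with hs
  have hub : ∀ r ∈ s, r ≤ lagSum n (β i₁) / (n : ℝ) ^ 2 + ε := by
    rintro r ⟨f, hf, rfl⟩
    have hf' : ∑ x, f x ^ 2 * π x ≤ 1 := by simpa using (Real.sqrt_le_iff.mp hf).2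
    have h1 := (hmse f hf').2
    have h2 : ∑ k ∈ univ.erase o, lagSum n (β k) * piCoeff π (u k) f ^ 2 ≤
        lagSum n (β i₁) := by
      calc _ ≤ ∑ k ∈ univ.erase o, lagSum n (β i₁) * piCoeff π (u k) f ^ 2 := by
            refine Finset.sum_le_sum fun k hk => ?_
            have hk' := Finset.ne_of_mem_erase hk
            exact mul_le_mul_of_nonneg_right
              (monotoneOn_lagSum n (hIcc k hk') (hIcc i₁ hi₁) (hmax k hk')) (sq_nonneg _)
        _ = lagSum n (β i₁) * ∑ k ∈ univ.erase o, piCoeff π (u k) f ^ 2 := by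
            rw [Finset.mul_sum]
        _ ≤ lagSum n (β i₁) * 1 := by
            refine mul_le_mul_of_nonneg_left ?_ (lagSum_nonneg n (hIcc i₁ hi₁))
            refine le_trans (Finset.sum_le_sum_of_subset_of_nonneg (Finset.subset_univ _)
              fun k _ _ => sq_nonneg _) ((sum_piCoeff_sq hcard horth f).trans_le hf')
        _ = _ := mul_one _
    have h3 : (∑ k ∈ univ.erase o, lagSum n (β k) * piCoeff π (u k) f ^ 2) / (n : ℝ) ^ 2 ≤
        lagSum n (β i₁) / (n : ℝ) ^ 2 := by gcongr
    linarith
  have hnorm : ∑ x, u i₁ x ^ 2 * π x = 1 := by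
    simpa [sq] using horth i₁ i₁
  have hmem : mse P π ν (u i₁) n n₀ ∈ s := ⟨u i₁, by rw [hnorm, Real.sqrt_one], rfl⟩
  have hle : sSup s ≤ lagSum n (β i₁) / (n : ℝ) ^ 2 + ε := csSup_le ⟨_, hmem⟩ hub
  have hge : lagSum n (β i₁) / (n : ℝ) ^ 2 - ε ≤ sSup s := by
    refine le_trans ?_ (le_csSup ⟨_, hub⟩ hmem)
    have h1 := (hmse (u i₁) hnorm.le).1
    have h2 : ∑ k ∈ univ.erase o, lagSum n (β k) * piCoeff π (u k) (u i₁) ^ 2 =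
        lagSum n (β i₁) := by
      have : ∀ k, piCoeff π (u k) (u i₁) = if i₁ = k then 1 else 0 := fun k => horth i₁ k
      simp [this, hi₁]
    rw [h2] at h1
    linarith
  exact abs_le.mpr ⟨by linarith, by linarith⟩

end Spectral

/-- Asymptotics of the worst-case error over `‖f‖₂ ≤ 1`: for a reversible `P` with
second largest eigenvalue `β₁`, second largest absolute eigenvalue `β < 1` and any
initial distribution `ν`,
`lim_{n→∞} n · sup_{‖f‖₂≤1} e_ν(S_{n,n₀},f)² = (1+β₁)/(1−β₁)` (for every `n₀`), and for
every fixed `n ≥ 1`,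
`lim_{n₀→∞} sup_{‖f‖₂≤1} e_ν(S_{n,n₀},f)² = (1+β₁)/(n(1−β₁)) − 2β₁(1−β₁ⁿ)/(n²(1−β₁)²)`. -/
theorem stmt8 {D : Type*} [Fintype D] [DecidableEq D] [Nonempty D]
    (P : Matrix D D ℝ) (π ν : D → ℝ)
    (hP0 : ∀ x y, 0 ≤ P x y) (hP1 : ∀ x, ∑ y, P x y = 1)
    (hπpos : ∀ x, 0 < π x) (hπ1 : ∑ x, π x = 1)
    (hrev : ∀ x y, π x * P x y = π y * P y x)
    (hν0 : ∀ x, 0 ≤ ν x) (hν1 : ∑ x, ν x = 1)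
    (hcard : 1 < Fintype.card D)
    (β : Fin (Fintype.card D) → ℝ) (u : Fin (Fintype.card D) → D → ℝ)
    (heig : ∀ k x, ∑ y, P x y * u k y = β k * u k x)
    (horth : ∀ k l, (∑ x, u k x * u l x * π x) = if k = l then 1 else 0)
    (hβ0 : β ⟨0, Fintype.card_pos⟩ = 1)
    (hu0 : ∀ x, u ⟨0, Fintype.card_pos⟩ x = 1)
    (hmono : ∀ k l, k ≤ l → β l ≤ β k)
    (hβtop : ∀ k, k ≠ (⟨0, Fintype.card_pos⟩ : Fin (Fintype.card D)) → β k < 1)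
    (hβbot : ∀ k, -1 ≤ β k)
    (b1 b : ℝ) (hb1 : b1 = β ⟨1, hcard⟩)
    (hb : b = max b1 |β ⟨Fintype.card D - 1, by omega⟩|) (hblt : b < 1) :
    (∀ n₀ : ℕ,
      Filter.Tendsto
        (fun n : ℕ => (n : ℝ) *
          sSup {r : ℝ | ∃ f : D → ℝ,
            Real.sqrt (∑ x, f x ^ 2 * π x) ≤ 1 ∧ r = mse P π ν f n n₀})
        Filter.atTop (nhds ((1 + b1) / (1 - b1)))) ∧
    ∀ n : ℕ, 1 ≤ n →
      Filter.Tendsto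
        (fun n₀ : ℕ =>
          sSup {r : ℝ | ∃ f : D → ℝ,
            Real.sqrt (∑ x, f x ^ 2 * π x) ≤ 1 ∧ r = mse P π ν f n n₀})
        Filter.atTop
        (nhds ((1 + b1) / ((n : ℝ) * (1 - b1)) -
          2 * b1 * (1 - b1 ^ n) / ((n : ℝ) ^ 2 * (1 - b1) ^ 2))) := by
  have ho : ∀ k : Fin (Fintype.card D), k ≠ ⟨0, Fintype.card_pos⟩ → 1 ≤ (k : ℕ) := fun k hk =>
    Nat.one_le_iff_ne_zero.mpr fun h => hk (Fin.ext h)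
  have hb0 : 0 ≤ b := hb ▸ le_max_of_le_right (abs_nonneg _)
  have hmax : ∀ k, k ≠ (⟨0, Fintype.card_pos⟩ : Fin (Fintype.card D)) →
      β k ≤ β ⟨1, hcard⟩ := fun k hk => hmono _ _ (Fin.le_def.mpr (ho k hk))
  have habs : ∀ k, k ≠ (⟨0, Fintype.card_pos⟩ : Fin (Fintype.card D)) → |β k| ≤ b := by
    intro k hk
    have hlast : β ⟨Fintype.card D - 1, by omega⟩ ≤ β k :=
      hmono _ _ (Fin.le_def.mpr (Nat.le_sub_one_of_lt k.2))
    have h1 := hmax k hk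
    rw [← hb1] at h1
    have h2 : b1 ≤ b := hb ▸ le_max_left _ _
    have h3 : |β ⟨Fintype.card D - 1, by omega⟩| ≤ b := hb ▸ le_max_right _ _
    exact abs_le.mpr ⟨(abs_le.mp h3).1.trans hlast, h1.trans h2⟩
  have hne : (⟨1, hcard⟩ : Fin (Fintype.card D)) ≠ ⟨0, Fintype.card_pos⟩ := by simp
  obtain ⟨C, hC⟩ := exists_abs_sSup_mse_sub_le (Fintype.card_fin _) hP1 heig horth hν1 hβ0 hu0
    hne hmax hb0 hblt habs
  rw [← hb1] at hC
  have hb1abs : |b1| < 1 := by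
    rw [hb1]
    exact (habs _ hne).trans_lt hblt
  have hb1lt : 0 < 1 - b1 := sub_pos.mpr (abs_lt.mp hb1abs).2
  have hlag : ∀ n : ℕ, lagSum n b1 =
      n * ((1 + b1) / (1 - b1)) - 2 * b1 * (1 - b1 ^ n) / (1 - b1) ^ 2 := by
    intro n
    have := lagSum_mul_one_sub_sq n b1
    rw [eq_div_of_mul_eq (by positivity) this]
    field_simp
    ring
  refine ⟨fun n₀ => ?_, fun n hn => ?_⟩
  · have hinv : Filter.Tendsto (fun n : ℕ => (n : ℝ)⁻¹) Filter.atTop (nhds 0) :=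
      tendsto_inv_atTop_nhds_zero_nat
    have hmain : Filter.Tendsto (fun n : ℕ => (1 + b1) / (1 - b1) -
        2 * b1 * (1 - b1 ^ n) / (1 - b1) ^ 2 * (n : ℝ)⁻¹) Filter.atTop
        (nhds ((1 + b1) / (1 - b1))) := by
      have hp := tendsto_pow_atTop_nhds_zero_of_abs_lt_one hb1abs
      have := tendsto_const_nhds (x := (1 + b1) / (1 - b1)) |>.sub
        ((((tendsto_const_nhds (x := (1 : ℝ))).sub hp).const_mul (2 * b1) |>.div_const
          ((1 - b1) ^ 2)).mul hinv)
      simpa using this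
    have herr : Filter.Tendsto (fun n : ℕ => C * b ^ n₀ * (n : ℝ)⁻¹) Filter.atTop
        (nhds 0) := by
      simpa using hinv.const_mul (C * b ^ n₀)
    refine hmain.congr_dist (squeeze_zero' (Filter.Eventually.of_forall fun _ => dist_nonneg)
      ?_ herr)
    filter_upwards [Filter.eventually_ne_atTop 0] with n hn
    have hn' : (0 : ℝ) < n := by exact_mod_cast Nat.pos_of_ne_zero hn
    have h := mul_le_mul_of_nonneg_left (hC n n₀ hn) hn'.le
    rw [dist_comm, Real.dist_eq]
    refine le_trans (le_of_eq ?_) (h.trans_eq ?_)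
    · rw [← abs_of_pos hn', ← abs_mul, abs_of_pos hn', hlag, mul_sub]
      congr 2
      field_simp
    · field_simp
  · have hn0 : n ≠ 0 := Nat.one_le_iff_ne_zero.mp hn
    have hn' : (n : ℝ) ≠ 0 := by exact_mod_cast hn0
    have hval : (1 + b1) / ((n : ℝ) * (1 - b1)) -
        2 * b1 * (1 - b1 ^ n) / ((n : ℝ) ^ 2 * (1 - b1) ^ 2) =
        lagSum n b1 / (n : ℝ) ^ 2 := by
      rw [hlag]
      field_simp
    rw [hval, tendsto_iff_dist_tendsto_zero]
    have herr : Filter.Tendsto (fun n₀ : ℕ => C * b ^ n₀ / (n : ℝ) ^ 2) Filter.atTop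
        (nhds 0) := by
      simpa using ((tendsto_pow_atTop_nhds_zero_of_lt_one hb0 hblt).const_mul C).div_const
        ((n : ℝ) ^ 2)
    exact squeeze_zero (fun _ => dist_nonneg) (fun n₀ => hC n n₀ hn0) herr
end

section
/- Let β ∈ (0,1), C > 0, N > 0 and η > 0 satisfy C > (log(β⁻¹)/(1−β))^{1/η} and N > (1+η)·log(C)/log(β⁻¹) + 2·(log(β⁻¹) − (1−β))⁻¹. Define est(n,n₀) = √( 2/(n(1−β)) + 2Cβ^{n₀}/(n²(1−β)²) ). Then there exists n_opt ∈ [log(C)/log(β⁻¹), (1+η)·log(C)/log(β⁻¹)] which minimizes the mapping n₀ ↦ est(N − n₀, n₀). -/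
/-- `est(n,n₀) = √( 2/(n(1-β)) + 2Cβ^{n₀}/(n²(1-β)²) )` (real burn-in `n₀`, via `rpow`). -/
noncomputable def est (b C n n₀ : ℝ) : ℝ :=
  Real.sqrt (2 / (n * (1 - b)) + 2 * C * b ^ n₀ / (n ^ 2 * (1 - b) ^ 2))

theorem hasDerivAt_est_radicand {b C N s : ℝ} (hb : 0 < b) (hb1 : b < 1) (hs : s < N) :
    HasDerivAt
      (fun x : ℝ => 2 / ((N - x) * (1 - b)) + 2 * C * b ^ x / ((N - x) ^ 2 * (1 - b) ^ 2))
      (2 / ((N - s) ^ 2 * (1 - b) ^ 2) *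
        (1 - b - C * b ^ s * (Real.log b⁻¹ - 2 / (N - s)))) s := by
  have hn : N - s ≠ 0 := (sub_pos.2 hs).ne'
  have hd : 1 - b ≠ 0 := (sub_pos.2 hb1).ne'
  have hlin : HasDerivAt (fun x : ℝ => N - x) (-1) s := by
    simpa using (hasDerivAt_id s).const_sub N
  have hpow : HasDerivAt (fun x : ℝ => b ^ x) (b ^ s * Real.log b) s :=
    (Real.hasStrictDerivAt_const_rpow hb s).hasDerivAt
  have h₁ := (hasDerivAt_const s (2 : ℝ)).fun_div (hlin.mul_const (1 - b)) (mul_ne_zero hn hd)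
  have h₂ := (hpow.const_mul (2 * C)).fun_div ((hlin.fun_pow 2).mul_const ((1 - b) ^ 2))
    (mul_ne_zero (pow_ne_zero 2 hn) (pow_ne_zero 2 hd))
  refine (h₁.fun_add h₂).congr_deriv ?_
  rw [Real.log_inv]
  field_simp
  ring

/-- A function that decreases on `[a, p]` and increases on `[q, c)` attains its minimum over
`[a, c)` inside `[p, q]`. -/
theorem exists_mem_Icc_forall_le_of_antitoneOn_of_monotoneOn {f : ℝ → ℝ} {a p q c : ℝ}
    (hap : a ≤ p) (hpq : p ≤ q) (hqc : q < c) (hf : ContinuousOn f (Set.Icc p q))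
    (hanti : AntitoneOn f (Set.Icc a p)) (hmono : MonotoneOn f (Set.Ico q c)) :
    ∃ t ∈ Set.Icc p q, ∀ s, a ≤ s → s < c → f t ≤ f s := by
  obtain ⟨t, ht, hmin⟩ := isCompact_Icc.exists_isMinOn (Set.nonempty_Icc.2 hpq) hf
  refine ⟨t, ht, fun s hs hsc => ?_⟩
  rcases le_total s p with hsp | hps
  · exact (hmin (Set.left_mem_Icc.2 hpq)).trans (hanti ⟨hs, hsp⟩ ⟨hap, le_rfl⟩ hsp)
  rcases le_total s q with hsq | hqs
  · exact hmin ⟨hps, hsq⟩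
  · exact (hmin (Set.right_mem_Icc.2 hpq)).trans (hmono ⟨le_rfl, hqc⟩ ⟨hqs, hsc⟩ hqs)

/-- If `C > (log β⁻¹/(1-β))^{1/η}` and
`N > (1+η)·log C/log β⁻¹ + 2(log β⁻¹ - (1-β))⁻¹`, then there is an
`n_opt ∈ [log C/log β⁻¹, (1+η) log C/log β⁻¹]` minimizing `n₀ ↦ est(N-n₀,n₀)`. -/
theorem stmt10 (b C N η : ℝ) (hb : b ∈ Set.Ioo (0 : ℝ) 1) (hC : 0 < C) (hη : 0 < η)
    (hC2 : (Real.log b⁻¹ / (1 - b)) ^ (1 / η) < C)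
    (hN : (1 + η) * Real.log C / Real.log b⁻¹ + 2 / (Real.log b⁻¹ - (1 - b)) < N) :
    ∃ t ∈ Set.Icc (Real.log C / Real.log b⁻¹) ((1 + η) * Real.log C / Real.log b⁻¹),
      ∀ s : ℝ, 0 ≤ s → s < N → est b C (N - t) t ≤ est b C (N - s) s := by
  obtain ⟨hb0, hb1⟩ := hb
  have hd : 0 < 1 - b := sub_pos.2 hb1
  have hdL : 1 - b < Real.log b⁻¹ := by
    have := Real.log_lt_sub_one_of_pos hb0 hb1.ne
    rw [Real.log_inv]
    linarith
  have hderiv := fun {s : ℝ} (hs : s < N) => hasDerivAt_est_radicand (C := C) hb0 hb1 hs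
  set L := Real.log b⁻¹ with hLdef
  have hL : 0 < L := hd.trans hdL
  have hCexp : Real.exp (Real.log C) = C := Real.exp_log hC
  have hratio : Real.log (L / (1 - b)) < η * Real.log C := by
    have h := Real.log_lt_log (by positivity) hC2
    rw [Real.log_rpow (by positivity), one_div, inv_mul_lt_iff₀ hη] at h
    exact h
  have hlogC : 0 < Real.log C :=
    pos_of_mul_pos_right ((Real.log_pos ((one_lt_div hd).2 hdL)).trans hratio) hη.le
  have hu : ∀ s : ℝ, C * b ^ s = Real.exp (Real.log C - L * s) := fun s => by
    rw [Real.rpow_def_of_pos hb0, sub_eq_add_neg, Real.exp_add, hCexp, hLdef, Real.log_inv]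
    ring_nf
  have hgap : 0 < 2 / (L - (1 - b)) := div_pos two_pos (sub_pos.2 hdL)
  have hqN : (1 + η) * Real.log C / L < N := by linarith
  have hpq : Real.log C / L ≤ (1 + η) * Real.log C / L := by
    gcongr
    nlinarith
  have hcont : ContinuousOn
      (fun x : ℝ => 2 / ((N - x) * (1 - b)) + 2 * C * b ^ x / ((N - x) ^ 2 * (1 - b) ^ 2))
      (Set.Iio N) := fun s hs => (hderiv hs).continuousAt.continuousWithinAt
  have hanti : AntitoneOn
      (fun x : ℝ => 2 / ((N - x) * (1 - b)) + 2 * C * b ^ x / ((N - x) ^ 2 * (1 - b) ^ 2))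
      (Set.Icc 0 (Real.log C / L)) := by
    refine antitoneOn_of_hasDerivWithinAt_nonpos (convex_Icc _ _)
      (hcont.mono fun s hs => (hs.2.trans hpq).trans_lt hqN)
      (fun s hs => (hderiv ?_).hasDerivWithinAt) fun s hs => ?_
    · exact ((interior_subset hs).2.trans hpq).trans_lt hqN
    · have hs' : s ≤ Real.log C / L := (interior_subset hs).2
      refine mul_nonpos_of_nonneg_of_nonpos (by positivity) ?_
      have hn : 2 / (L - (1 - b)) < N - s := by linarith
      have hrate : 1 - b < L - 2 / (N - s) := by
        have : 2 / (N - s) < L - (1 - b) :=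
          (div_lt_comm₀ (sub_pos.2 hdL) (hgap.trans hn)).1 hn
        linarith
      have hone : 1 ≤ C * b ^ s := by
        rw [hu, Real.one_le_exp_iff]
        rw [le_div_iff₀ hL] at hs'
        linarith
      nlinarith
  have hmono : MonotoneOn
      (fun x : ℝ => 2 / ((N - x) * (1 - b)) + 2 * C * b ^ x / ((N - x) ^ 2 * (1 - b) ^ 2))
      (Set.Ico ((1 + η) * Real.log C / L) N) := by
    refine monotoneOn_of_hasDerivWithinAt_nonneg (convex_Ico _ _)
      (hcont.mono fun s hs => hs.2)
      (fun s hs => (hderiv (interior_subset hs).2).hasDerivWithinAt) fun s hs => ?_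
    have hs' : (1 + η) * Real.log C / L ≤ s := (interior_subset hs).1
    have hn : 0 < N - s := sub_pos.2 (interior_subset hs).2
    refine mul_nonneg (by positivity) ?_
    have hsmall : C * b ^ s ≤ (1 - b) / L := by
      rw [hu, ← Real.le_log_iff_exp_le (by positivity), ← inv_div, Real.log_inv]
      rw [div_le_iff₀ hL] at hs'
      linarith
    rw [le_div_iff₀ hL] at hsmall
    have : 0 ≤ C * b ^ s * (2 / (N - s)) := by positivity
    linarith
  obtain ⟨t, ht, hmin⟩ := exists_mem_Icc_forall_le_of_antitoneOn_of_monotoneOn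
    (div_nonneg hlogC.le hL.le) hpq hqN
    (hcont.mono fun s hs => hs.2.trans_lt hqN) hanti hmono
  exact ⟨t, ht, fun s hs hsN => Real.sqrt_le_sqrt (hmin s hs hsN)⟩
end

section
/- For every p ∈ (2,∞], every β with 0 ≤ β < 1, and every n ∈ ℕ, the quantity V(β,n,p) satisfies V(β,n,p) ≤ 64p/((p−2)(1−β)²), where V(β,n,p) = 4·( 2^{4/p} Σ_{j=1}^n β^{2j(p−2)/p} + 2^{(3p+2)/p} Σ_{j=1}^{n−1} β^{2j(p−3)/p} Σ_{k=j+1}^n β^{2k/p} ) for p ∈ (2,4), and V(β,n,p) = 4·( 2 Σ_{j=1}^n β^j + 2^{(3p+2)/p} Σ_{j=1}^{n−1} β^{2j/p} Σ_{k=j+1}^n β^{k(p−2)/p} ) for p ∈ [4,∞] (with the convention p/(p) = 1 terms interpreted by continuity at p = ∞). -/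
/-- `V(β,n,p)` for finite `p ∈ (2,∞)` (the two regimes `p ∈ (2,4)` and `p ∈ [4,∞)`). -/
noncomputable def V (b : ℝ) (n : ℕ) (p : ℝ) : ℝ :=
  if p < 4 then
    4 * ((2 : ℝ) ^ (4 / p) * ∑ j ∈ Finset.Icc 1 n, b ^ (2 * (j : ℝ) * (p - 2) / p) +
      (2 : ℝ) ^ ((3 * p + 2) / p) * ∑ j ∈ Finset.Icc 1 (n - 1),
        b ^ (2 * (j : ℝ) * (p - 3) / p) * ∑ k ∈ Finset.Icc (j + 1) n, b ^ (2 * (k : ℝ) / p))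
  else
    4 * (2 * ∑ j ∈ Finset.Icc 1 n, b ^ (j : ℕ) +
      (2 : ℝ) ^ ((3 * p + 2) / p) * ∑ j ∈ Finset.Icc 1 (n - 1),
        b ^ (2 * (j : ℝ) / p) * ∑ k ∈ Finset.Icc (j + 1) n, b ^ ((k : ℝ) * (p - 2) / p))

/-- `V(β,n,∞)`: the case `p = ∞`, with exponents `4/p, (3p+2)/p, 2j/p, k(p-2)/p` read as
their limits `0, 3, 0, k` (so `2^{(3p+2)/p} = 8`). -/
noncomputable def Vinf (b : ℝ) (n : ℕ) : ℝ :=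
  4 * (2 * ∑ j ∈ Finset.Icc 1 n, b ^ j +
    8 * ∑ j ∈ Finset.Icc 1 (n - 1), ∑ k ∈ Finset.Icc (j + 1) n, b ^ k)

lemma one_sub_rpow_ge {b s : ℝ} (hb0 : 0 ≤ b) (hs0 : 0 ≤ s) (hs1 : s ≤ 1) :
    s * (1 - b) ≤ 1 - b ^ s := by
  have h := rpow_one_add_le_one_add_mul_self (s := b - 1) (by linarith) hs0 hs1
  rw [add_sub_cancel] at h
  linarith

lemma sum_rpow_mul_le {b s : ℝ} (hb0 : 0 ≤ b) (hb1 : b < 1) (hs0 : 0 < s) (hs1 : s ≤ 1)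
    (m n : ℕ) :
    ∑ k ∈ Finset.Icc m n, b ^ (s * (k : ℝ)) ≤ (b ^ s) ^ m / (s * (1 - b)) := by
  have hpos : 0 < s * (1 - b) := mul_pos hs0 (by linarith)
  have hx0 : 0 ≤ b ^ s := Real.rpow_nonneg hb0 s
  have hx := one_sub_rpow_ge hb0 hs0.le hs1
  simp_rw [Real.rpow_mul_natCast hb0, ← Finset.Ico_succ_right_eq_Icc]
  refine (geom_sum_Ico_le_of_lt_one hx0 (by linarith)).trans ?_
  gcongr

lemma double_sum_rpow_le {b s t : ℝ} (hb0 : 0 ≤ b) (hb1 : b < 1) (hs0 : 0 < s) (hs1 : s ≤ 1)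
    (ht0 : 0 < t) (ht1 : t ≤ 1) (e : ℕ → ℝ) (he : ∀ j : ℕ, s * j ≤ e j + t * (j + 1))
    (m n : ℕ) :
    ∑ j ∈ Finset.Icc 1 m, b ^ e j * ∑ k ∈ Finset.Icc (j + 1) n, b ^ (t * (k : ℝ)) ≤
      1 / (s * (1 - b) * (t * (1 - b))) := by
  have hs : 0 < s * (1 - b) := mul_pos hs0 (by linarith)
  have ht : 0 < t * (1 - b) := mul_pos ht0 (by linarith)
  have hterm : ∀ j : ℕ, b ^ e j * (b ^ t) ^ (j + 1) ≤ b ^ (s * (j : ℝ)) := by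
    intro j
    rcases hb0.eq_or_lt with rfl | hb
    · simpa [Real.zero_rpow ht0.ne'] using Real.rpow_nonneg le_rfl (s * (j : ℝ))
    · rw [← Real.rpow_mul_natCast hb0, ← Real.rpow_add hb]
      exact Real.rpow_le_rpow_of_exponent_ge hb hb1.le (by push_cast; exact he j)
  calc
    _ ≤ ∑ j ∈ Finset.Icc 1 m, b ^ (s * (j : ℝ)) / (t * (1 - b)) := by
      refine Finset.sum_le_sum fun j _ => ?_
      refine (mul_le_mul_of_nonneg_left (sum_rpow_mul_le hb0 hb1 ht0 ht1 (j + 1) n)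
        (Real.rpow_nonneg hb0 _)).trans ?_
      rw [← mul_div_assoc]
      exact div_le_div_of_nonneg_right (hterm j) ht.le
    _ ≤ 1 / (s * (1 - b)) / (t * (1 - b)) := by
      rw [← Finset.sum_div]
      refine div_le_div_of_nonneg_right ((sum_rpow_mul_le hb0 hb1 hs0 hs1 1 m).trans ?_) ht.le
      refine div_le_div_of_nonneg_right ?_ hs.le
      rw [pow_one]
      exact Real.rpow_le_one hb0 hb1.le hs0.le
    _ = _ := div_div _ _ _

lemma sum_rpow_mul_le_inv {b s : ℝ} (hb0 : 0 ≤ b) (hb1 : b < 1) (hs0 : 0 < s) (hs1 : s ≤ 1)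
    (n : ℕ) :
    ∑ k ∈ Finset.Icc 1 n, b ^ (s * (k : ℝ)) ≤ 1 / (s * (1 - b) ^ 2) := by
  have hb : 0 < 1 - b := by linarith
  refine (sum_rpow_mul_le hb0 hb1 hs0 hs1 1 n).trans ?_
  rw [pow_one]
  gcongr
  · exact Real.rpow_le_one hb0 hb1.le hs0.le
  · nlinarith

lemma two_rpow_le {p : ℝ} (hp : 2 < p) : (2 : ℝ) ^ ((3 * p + 2) / p) ≤ 8 * (1 + 2 / p) := by
  have h0 : 0 < p := by linarith
  have h := rpow_one_add_le_one_add_mul_self (s := 1) (p := 2 / p) (by norm_num)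
    (by positivity) ((div_le_one h0).2 hp.le)
  rw [show (3 * p + 2) / p = ((3 : ℕ) : ℝ) + 2 / p by field_simp; norm_num [mul_comm],
    Real.rpow_add two_pos, Real.rpow_natCast]
  norm_num at h ⊢
  exact h

lemma V_le_of_lt_four {b : ℝ} (hb0 : 0 ≤ b) (hb1 : b < 1) (n : ℕ) {p : ℝ} (hp : 2 < p)
    (hp4 : p < 4) : V b n p ≤ 64 * p / ((p - 2) * (1 - b) ^ 2) := by
  have h0 : 0 < p := by linarith
  have hp2 : 0 < p - 2 := by linarith
  have hb : 0 < 1 - b := by linarith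
  have hs0 : 0 < 2 * (p - 2) / p := by positivity
  have hs1 : 2 * (p - 2) / p ≤ 1 := (div_le_one h0).2 (by linarith)
  have hA := sum_rpow_mul_le_inv hb0 hb1 hs0 hs1 n
  have hD := double_sum_rpow_le hb0 hb1 hs0 hs1 (t := 2 / p) (by positivity)
    ((div_le_one h0).2 hp.le) (fun j => 2 * (j : ℝ) * (p - 3) / p)
    (fun j => by
      have : 0 < 2 / p := by positivity
      have : 2 * (j : ℝ) * (p - 3) / p + 2 / p * (j + 1) = 2 * (p - 2) / p * j + 2 / p := by
        field_simp
        ring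
      linarith) (n - 1) n
  have h4 : (2 : ℝ) ^ (4 / p) ≤ 4 := by
    calc (2 : ℝ) ^ (4 / p) ≤ 2 ^ (2 : ℝ) :=
          Real.rpow_le_rpow_of_exponent_le one_le_two ((div_le_iff₀ h0).2 (by linarith))
      _ = 4 := by norm_num
  rw [V, if_pos hp4]
  simp_rw [show ∀ j : ℕ, 2 * (j : ℝ) * (p - 2) / p = 2 * (p - 2) / p * j from
    fun j => by ring, show ∀ k : ℕ, 2 * (k : ℝ) / p = 2 / p * k from fun k => by ring]
  calc
    _ ≤ 4 * (4 * (1 / (2 * (p - 2) / p * (1 - b) ^ 2)) + 8 * (1 + 2 / p) *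
        (1 / (2 * (p - 2) / p * (1 - b) * (2 / p * (1 - b))))) := by
      gcongr
      exact two_rpow_le hp
    _ = p * (8 + 8 * (p + 2)) / ((p - 2) * (1 - b) ^ 2) := by
      field_simp
      ring
    _ ≤ _ := by
      gcongr ?_ / _
      nlinarith

lemma V_le_of_four_le {b : ℝ} (hb0 : 0 ≤ b) (hb1 : b < 1) (n : ℕ) {p : ℝ} (hp4 : 4 ≤ p) :
    V b n p ≤ 64 * p / ((p - 2) * (1 - b) ^ 2) := by
  have h0 : 0 < p := by linarith
  have hp2 : 0 < p - 2 := by linarith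
  have hb : 0 < 1 - b := by linarith
  have ht0 : 0 < (p - 2) / p := by positivity
  have hA := sum_rpow_mul_le_inv hb0 hb1 one_pos le_rfl n
  have hD := double_sum_rpow_le hb0 hb1 one_pos le_rfl ht0
    ((div_le_one h0).2 (by linarith)) (fun j => 2 * (j : ℝ) / p)
    (fun j => by
      have : 2 * (j : ℝ) / p + (p - 2) / p * (j + 1) = 1 * j + (p - 2) / p := by
        field_simp
        ring
      linarith) (n - 1) n
  have hc : (2 : ℝ) ^ ((3 * p + 2) / p) ≤ 12 := by
    refine (two_rpow_le (by linarith)).trans ?_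
    have : 2 / p ≤ 1 / 2 := by
      rw [div_le_div_iff₀ h0 two_pos]
      linarith
    linarith
  rw [V, if_neg hp4.not_gt]
  simp_rw [one_mul, Real.rpow_natCast] at hA
  simp_rw [show ∀ k : ℕ, (k : ℝ) * (p - 2) / p = (p - 2) / p * k from fun k => by ring]
  calc
    _ ≤ 4 * (2 * (1 / (1 - b) ^ 2) + 12 *
        (1 / (1 * (1 - b) * ((p - 2) / p * (1 - b))))) := by
      gcongr
    _ = (8 * (p - 2) + 48 * p) / ((p - 2) * (1 - b) ^ 2) := by
      field_simp
      ring
    _ ≤ _ := by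
      gcongr ?_ / _
      linarith

lemma Vinf_le {b : ℝ} (hb0 : 0 ≤ b) (hb1 : b < 1) (n : ℕ) : Vinf b n ≤ 64 / (1 - b) ^ 2 := by
  have hb : 0 < 1 - b := by linarith
  have hA := sum_rpow_mul_le_inv hb0 hb1 one_pos le_rfl n
  have hD := double_sum_rpow_le hb0 hb1 one_pos le_rfl one_pos le_rfl (fun _ => 0)
    (fun j => by linarith) (n - 1) n
  simp_rw [one_mul, Real.rpow_zero, one_mul, Real.rpow_natCast, ← sq] at hA hD
  have hpos : 0 ≤ 1 / (1 - b) ^ 2 := by positivity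
  rw [Vinf, show 64 / (1 - b) ^ 2 = 64 * (1 / (1 - b) ^ 2) by ring]
  linarith

/-- For every `p ∈ (2,∞]`, `0 ≤ β < 1` and `n`, one has `V(β,n,p) ≤ 64p/((p-2)(1-β)²)`
(with value `64/(1-β)²` for `p = ∞`). -/
theorem stmt18 (b : ℝ) (hb0 : 0 ≤ b) (hb1 : b < 1) (n : ℕ) :
    (∀ p : ℝ, 2 < p → V b n p ≤ 64 * p / ((p - 2) * (1 - b) ^ 2)) ∧
    Vinf b n ≤ 64 / (1 - b) ^ 2 := by
  exact ⟨fun p hp => (lt_or_ge p 4).elim (V_le_of_lt_four hb0 hb1 n hp)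
    (V_le_of_four_le hb0 hb1 n), Vinf_le hb0 hb1 n⟩
end
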